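/- arXiv:2512.20101 — 2 statements merged into one kernel-verified Lean document; each statement's English description precedes it below -/
import Mathlib

section
/- Let A be a unital C*-algebra, I a proper closed two-sided ideal of A, and x an extreme point of the closed unit ball of A. Then x ∉ I; in fact dist(x, I) = 1, and the image x + I is an extreme point of the closed unit ball of the quotient C*-algebra A/I. -/
section Ideal

variable {A : Type*} [NormedRing A]

/-- Membership in a closed two-sided ideal is detected by the quotient seminorm. -/
lemma TwoSidedIdeal.mem_iff_infDist_eq_zero {I : TwoSidedIdeal A} (hI : IsClosed (I : Set A))
    {a : A} : a ∈ I ↔ Metric.infDist a (I : Set A) = 0 :=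
  hI.mem_iff_infDist_zero ⟨0, I.zero_mem⟩

lemma TwoSidedIdeal.exists_sub_mem_norm_lt {I : TwoSidedIdeal A} {a : A} {r : ℝ}
    (h : Metric.infDist a (I : Set A) < r) : ∃ b, a - b ∈ I ∧ ‖b‖ < r := by
  obtain ⟨i, hi, hlt⟩ := (Metric.infDist_lt_iff ⟨0, I.zero_mem⟩).1 h
  exact ⟨a - i, by simpa using hi, by rwa [← dist_eq_norm]⟩

lemma TwoSidedIdeal.infDist_le_of_sub_mem {I : TwoSidedIdeal A} {a b : A} (h : a - b ∈ I) :
    Metric.infDist a (I : Set A) ≤ Metric.infDist b (I : Set A) := by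
  refine (Metric.le_infDist ⟨0, I.zero_mem⟩).2 fun i hi ↦ ?_
  have hmem : (a - b) + i ∈ (I : Set A) := I.add_mem h hi
  refine (Metric.infDist_le_dist_of_mem hmem).trans_eq ?_
  rw [dist_eq_norm, dist_eq_norm]
  congr 1
  abel

lemma TwoSidedIdeal.real_smul_mem [NormedAlgebra ℝ A] {I : TwoSidedIdeal A} {a : A} (r : ℝ)
    (h : a ∈ I) : r • a ∈ I := by
  simpa using I.mul_mem_left (r • 1) a h

lemma TwoSidedIdeal.pow_sub_pow_mem {I : TwoSidedIdeal A} {a b : A} (h : a - b ∈ I) (n : ℕ) :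
    a ^ n - b ^ n ∈ I := by
  induction n with
  | zero => simp
  | succ n ih =>
    have : a ^ (n + 1) - b ^ (n + 1) = a ^ n * (a - b) + (a ^ n - b ^ n) * b := by
      rw [pow_succ, pow_succ]; noncomm_ring
    rw [this]
    exact I.add_mem (I.mul_mem_left _ _ h) (I.mul_mem_right _ _ ih)

/-- An idempotent congruent to a strict contraction modulo a closed ideal lies in the ideal. -/
lemma TwoSidedIdeal.mem_of_isIdempotentElem_of_sub_mem {I : TwoSidedIdeal A}
    (hI : IsClosed (I : Set A)) {p c : A} (hp : IsIdempotentElem p) (h : p - c ∈ I)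
    (hc : ‖c‖ < 1) : p ∈ I := by
  have hlim : Filter.Tendsto (fun n : ℕ ↦ p - c ^ (n + 1)) Filter.atTop (nhds (p - 0)) :=
    tendsto_const_nhds.sub
      ((tendsto_pow_atTop_nhds_zero_of_norm_lt_one hc).comp (Filter.tendsto_add_atTop_nat 1))
  rw [sub_zero] at hlim
  refine hI.mem_of_tendsto hlim (Filter.Eventually.of_forall fun n ↦ ?_)
  have := I.pow_sub_pow_mem h (n + 1)
  rwa [hp.pow_succ_eq] at this

end Ideal

section ClosedIdeal

variable {A : Type*} [CStarAlgebra A] [PartialOrder A] [StarOrderedRing A]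

/-- An element is a contraction as soon as `star a * a ≤ 1`. -/
lemma norm_le_one_of_star_mul_self_le_one {a : A} (h : star a * a ≤ 1) : ‖a‖ ≤ 1 := by
  have h1 : ‖star a * a‖ ≤ 1 :=
    (CStarAlgebra.norm_le_one_iff_of_nonneg _ (star_mul_self_nonneg a)).2 h
  rw [CStarRing.norm_star_mul_self] at h1
  nlinarith [norm_nonneg a]

lemma star_mul_self_le_one_of_norm_le_one {a : A} (h : ‖a‖ ≤ 1) : star a * a ≤ 1 := by
  refine (CStarAlgebra.norm_le_one_iff_of_nonneg _ (star_mul_self_nonneg a)).1 ?_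
  rw [CStarRing.norm_star_mul_self]
  nlinarith [norm_nonneg a]

/-- An extreme point of the closed unit ball of a C⋆-algebra is a partial isometry. -/
lemma mul_star_mul_self_of_extreme {x : A} (hx : ‖x‖ ≤ 1)
    (hext : ∀ y z : A, ‖y‖ ≤ 1 → ‖z‖ ≤ 1 → x = (2⁻¹ : ℝ) • (y + z) → y = x ∧ z = x) :
    x * star x * x = x := by
  set s : A := 1 - star x * x with hs
  have hs0 : 0 ≤ s := sub_nonneg.2 (star_mul_self_le_one_of_norm_le_one hx)
  have hsa : star s = s := hs0.star_eq
  have hb : star x * x = 1 - s := by simp [hs]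
  have hs1 : s ≤ 1 := by
    rw [hs]; exact sub_le_self _ (star_mul_self_nonneg x)
  have hy : ‖x * (1 + (2⁻¹ : ℝ) • s)‖ ≤ 1 := by
    apply norm_le_one_of_star_mul_self_le_one
    have h2 : 0 ≤ s * s := by simpa [hsa] using star_mul_self_nonneg s
    have h3 : 0 ≤ s * s * s := by simpa [hsa] using star_left_conjugate_nonneg hs0 s
    have : 1 - star (x * (1 + (2⁻¹ : ℝ) • s)) * (x * (1 + (2⁻¹ : ℝ) • s))
        = (3 / 4 : ℝ) • (s * s) + (4⁻¹ : ℝ) • (s * s * s) := by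
      have : star (x * (1 + (2⁻¹ : ℝ) • s)) * (x * (1 + (2⁻¹ : ℝ) • s))
          = (1 + (2⁻¹ : ℝ) • s) * (star x * x) * (1 + (2⁻¹ : ℝ) • s) := by
        simp [hsa, mul_assoc]
      rw [this, hb]
      simp only [mul_add, add_mul, mul_sub, sub_mul, mul_one, one_mul, smul_mul_assoc,
        mul_smul_comm, mul_assoc]
      module
    rw [← sub_nonneg, this]
    positivity
  have hz : ‖x * (1 - (2⁻¹ : ℝ) • s)‖ ≤ 1 := by
    refine (norm_mul_le _ _).trans (mul_le_one₀ hx (norm_nonneg _) ?_)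
    have h1 : (2⁻¹ : ℝ) • s ≤ 1 := by
      calc (2⁻¹ : ℝ) • s ≤ (2⁻¹ : ℝ) • s + (2⁻¹ : ℝ) • s :=
            le_add_of_nonneg_right (by positivity)
        _ = s := by module
        _ ≤ 1 := hs1
    rw [CStarAlgebra.norm_le_one_iff_of_nonneg _ (sub_nonneg.2 h1)]
    exact sub_le_self _ (by positivity)
  have h := (hext _ _ hy hz (by rw [← mul_add]; simp [← two_smul ℝ, smul_smul])).1
  have h' : x * s = 0 := by
    have : (2⁻¹ : ℝ) • (x * s) = 0 := by
      simpa [mul_add] using h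
    simpa using this
  rw [hs, mul_sub, mul_one, sub_eq_zero] at h'
  rw [mul_assoc, ← h']

/-- If `x` is an extreme point of the closed unit ball, then the defect projections of `x`
are orthogonal across the whole algebra. -/
lemma defect_mul_mul_defect_of_extreme {x : A} (hx : ‖x‖ ≤ 1)
    (hext : ∀ y z : A, ‖y‖ ≤ 1 → ‖z‖ ≤ 1 → x = (2⁻¹ : ℝ) • (y + z) → y = x ∧ z = x) (a : A) :
    (1 - x * star x) * a * (1 - star x * x) = 0 := by
  have hxx := mul_star_mul_self_of_extreme hx hext
  have hxx' : star x * x * star x = star x := by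
    simpa [mul_assoc] using congrArg star hxx
  set p : A := 1 - star x * x with hp
  have hpsa : star p = p := by simp [hp]
  have hpp : p * p = p := by
    simp only [hp, mul_sub, sub_mul, one_mul, mul_one, ← mul_assoc, hxx']
    simp
  set w : A := (1 - x * star x) * a * p with hw
  have hxw : star x * w = 0 := by
    simp only [hw, ← mul_assoc, mul_sub, mul_one, hxx']
    simp
  have hwx : star w * x = 0 := by simpa using congrArg star hxw
  have hwp : w * p = w := by rw [hw, mul_assoc, hpp]
  obtain ⟨r, hr, hrw⟩ : ∃ r : ℝ, 0 < r ∧ ‖r • w‖ ≤ 1 := by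
    refine ⟨(1 + ‖w‖)⁻¹, by positivity, ?_⟩
    rw [norm_smul, Real.norm_of_nonneg (by positivity), inv_mul_le_iff₀ (by positivity)]
    linarith
  have key (t : ℝ) (ht : ‖t • w‖ ≤ 1) : ‖x + t • w‖ ≤ 1 := by
    apply norm_le_one_of_star_mul_self_le_one
    have h1 := star_left_conjugate_le_conjugate (star_mul_self_le_one_of_norm_le_one ht) p
    have h2 : star p * (star (t • w) * (t • w)) * p = star (t • w) * (t • w) := by
      have hwp' : p * star w = star w := by simpa [hpsa] using congrArg star hwp
      simp only [hpsa, star_smul, smul_mul_assoc, mul_smul_comm, mul_assoc, hwp]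
      simp only [← mul_assoc, hwp']
    rw [h2, mul_one, hpsa, hpp] at h1
    calc star (x + t • w) * (x + t • w) = star x * x + star (t • w) * (t • w) := by
          simp [add_mul, mul_add, hxw, hwx]
      _ ≤ star x * x + p := by gcongr
      _ = 1 := by simp [hp]
  have h := (hext (x + r • w) (x + (-r) • w) (key r hrw) (key (-r) (by simpa using hrw))
    (by module)).1
  simpa [hr.ne'] using h

/-- Modulo a two-sided ideal, `star a * a ≤ c + k` with `k` in the ideal
bounds the quotient seminorm of `a` by `√c`. -/
lemma TwoSidedIdeal.infDist_sq_le_of_star_mul_self_le (I : TwoSidedIdeal A) {a k : A} {c : ℝ}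
    (hc : 0 ≤ c) (hk : k ∈ I) (h : star a * a ≤ algebraMap ℝ A c + k) :
    Metric.infDist a (I : Set A) ^ 2 ≤ c := by
  refine le_of_forall_pos_le_add fun δ hδ ↦ ?_
  have hksa : IsSelfAdjoint k := by
    have h1 := (sub_nonneg.2 h).isSelfAdjoint
    have h2 : IsSelfAdjoint (algebraMap ℝ A c) := .algebraMap A (.all c)
    have h3 := (h1.add (IsSelfAdjoint.star_mul_self a)).sub h2
    simpa using h3
  have hpos (t : ℝ) : δ ^ 2 + t ^ 2 ≠ 0 := by positivity
  set u : A := cfc (fun t : ℝ ↦ δ ^ 2 / (δ ^ 2 + t ^ 2)) k with hu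
  have husa : star u = u := (IsSelfAdjoint.cfc : IsSelfAdjoint u).star_eq
  have hcont : Continuous fun t : ℝ ↦ δ ^ 2 / (δ ^ 2 + t ^ 2) := by
    fun_prop (disch := simpa using hpos)
  have hcont' : Continuous fun t : ℝ ↦ t / (δ ^ 2 + t ^ 2) := by
    fun_prop (disch := simpa using hpos)
  have hu1 : 1 - u ∈ I := by
    have : 1 - u = k * cfc (fun t : ℝ ↦ t / (δ ^ 2 + t ^ 2)) k := by
      have hmul : cfc (fun t : ℝ ↦ t * (t / (δ ^ 2 + t ^ 2))) k
          = k * cfc (fun t : ℝ ↦ t / (δ ^ 2 + t ^ 2)) k := by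
        rw [cfc_mul (fun t ↦ t) _ k continuousOn_id hcont'.continuousOn, cfc_id' ℝ k]
      rw [← hmul, hu, ← cfc_one ℝ k, ← cfc_sub ..]
      refine cfc_congr fun t _ ↦ ?_
      have := hpos t
      simp
      field_simp
      ring
    rw [this]
    exact I.mul_mem_right _ _ hk
  have hun : ‖u‖ ≤ 1 := by
    refine norm_cfc_le zero_le_one fun t _ ↦ ?_
    rw [Real.norm_of_nonneg (by positivity)]
    exact div_le_one_of_le₀ (by nlinarith [sq_nonneg t]) (by positivity)
  have huk : ‖u * k * u‖ ≤ δ := by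
    have : u * k = cfc (fun t : ℝ ↦ δ ^ 2 / (δ ^ 2 + t ^ 2) * t) k := by
      rw [cfc_mul _ (fun t ↦ t) k hcont.continuousOn continuousOn_id, cfc_id' ℝ k]
    have h1 : ‖u * k‖ ≤ δ := by
      rw [this]
      refine norm_cfc_le hδ.le fun t _ ↦ ?_
      rw [Real.norm_eq_abs, abs_mul, abs_of_nonneg (by positivity), div_mul_eq_mul_div,
        div_le_iff₀ (by positivity), ← sq_abs t]
      nlinarith [mul_nonneg hδ.le (sq_nonneg (δ - |t|)), abs_nonneg t,
        mul_nonneg hδ.le (sq_nonneg |t|), pow_pos hδ 3]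
    calc ‖u * k * u‖ ≤ ‖u * k‖ * ‖u‖ := norm_mul_le _ _
      _ ≤ δ * 1 := by gcongr
      _ = δ := mul_one _
  have h1 := star_left_conjugate_le_conjugate h u
  have h2 : star u * (star a * a) * u = star (a * u) * (a * u) := by simp [mul_assoc]
  have h3 : ‖a * u‖ ^ 2 ≤ c + δ := by
    rw [sq, ← CStarRing.norm_star_mul_self, ← h2]
    refine (CStarAlgebra.norm_le_norm_of_nonneg_of_le
      (star_left_conjugate_nonneg (star_mul_self_nonneg a) u) h1).trans ?_
    have : star u * (algebraMap ℝ A c + k) * u = c • (u * u) + u * k * u := by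
      simp [husa, mul_add, add_mul, Algebra.algebraMap_eq_smul_one]
    rw [this]
    refine (norm_add_le _ _).trans (add_le_add ?_ huk)
    rw [norm_smul, Real.norm_of_nonneg hc]
    exact mul_le_of_le_one_right hc ((norm_mul_le _ _).trans (mul_le_one₀ hun (norm_nonneg _) hun))
  have h4 : Metric.infDist a (I : Set A) ≤ ‖a * u‖ := by
    have : a * (1 - u) ∈ (I : Set A) := I.mul_mem_left _ _ hu1
    simpa [dist_eq_norm, mul_sub] using Metric.infDist_le_dist_of_mem (x := a) this
  exact (pow_le_pow_left₀ Metric.infDist_nonneg h4 2).trans h3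

/-- Closed two-sided ideals of a C⋆-algebra are closed under `star`. -/
lemma TwoSidedIdeal.star_mem_of_isClosed {I : TwoSidedIdeal A} (hI : IsClosed (I : Set A))
    {a : A} (ha : a ∈ I) : star a ∈ I := by
  rw [mem_iff_infDist_eq_zero hI]
  have := I.infDist_sq_le_of_star_mul_self_le (a := star a) (k := a * star a) le_rfl
    (I.mul_mem_right _ _ ha) (by simp)
  exact pow_eq_zero_iff two_ne_zero |>.1 (le_antisymm this (sq_nonneg _))

lemma TwoSidedIdeal.infDist_star_le {I : TwoSidedIdeal A} (hI : IsClosed (I : Set A)) (a : A) :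
    Metric.infDist (star a) (I : Set A) ≤ Metric.infDist a (I : Set A) := by
  refine (Metric.le_infDist ⟨0, I.zero_mem⟩).2 fun b hb ↦ ?_
  have : star b ∈ (I : Set A) := star_mem_of_isClosed hI hb
  refine (Metric.infDist_le_dist_of_mem this).trans ?_
  rw [dist_eq_norm, dist_eq_norm, ← star_sub, norm_star]

/-- If a partial isometry `x` is, modulo a closed ideal, the midpoint of two contractions,
then half of their difference vanishes on the initial projection of `x` modulo the ideal. -/
lemma TwoSidedIdeal.half_sub_mul_star_mul_self_mem {I : TwoSidedIdeal A}
    (hI : IsClosed (I : Set A)) {x y z : A} (hxx : x * star x * x = x)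
    (hy : Metric.infDist y (I : Set A) ≤ 1) (hz : Metric.infDist z (I : Set A) ≤ 1)
    (hm : x - (2⁻¹ : ℝ) • (y + z) ∈ I) :
    (2⁻¹ : ℝ) • (y - z) * (star x * x) ∈ I := by
  set p : A := star x * x with hp
  have hpp : p * p = p := by
    rw [hp, mul_assoc, ← mul_assoc x, hxx]
  have hpsa : star p = p := by simp [hp]
  have hp1 : p ≤ 1 := by
    have h : 0 ≤ star (1 - p) * (1 - p) := star_mul_self_nonneg _
    have h' : star (1 - p) * (1 - p) = 1 - p := by
      simp [hpsa, mul_sub, sub_mul, hpp]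
    rwa [h', sub_nonneg] at h
  rw [mem_iff_infDist_eq_zero hI]
  suffices Metric.infDist ((2⁻¹ : ℝ) • (y - z) * p) (I : Set A) ^ 2 ≤ 0 from
    pow_eq_zero_iff two_ne_zero |>.1 (le_antisymm this (sq_nonneg _))
  refine le_of_forall_pos_le_add fun c hc ↦ ?_
  rw [zero_add]
  have hlt : 1 < √(1 + c) := by rw [Real.lt_sqrt zero_le_one]; linarith
  obtain ⟨y', hy', hyn⟩ := exists_sub_mem_norm_lt (hy.trans_lt hlt)
  obtain ⟨z', hz', hzn⟩ := exists_sub_mem_norm_lt (hz.trans_lt hlt)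
  set m : A := (2⁻¹ : ℝ) • (y' + z') with hmdef
  set d : A := (2⁻¹ : ℝ) • (y' - z') with hddef
  have hxm : x - m ∈ I := by
    have : x - m = (x - (2⁻¹ : ℝ) • (y + z)) + (2⁻¹ : ℝ) • ((y - y') + (z - z')) := by
      rw [hmdef]; module
    rw [this]
    exact I.add_mem hm (real_smul_mem _ (I.add_mem hy' hz'))
  have hd : (2⁻¹ : ℝ) • (y - z) * p - d * p ∈ I := by
    have : (2⁻¹ : ℝ) • (y - z) * p - d * p = ((2⁻¹ : ℝ) • ((y - y') - (z - z'))) * p := by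
      rw [← sub_mul, hddef]; congr 1; module
    rw [this]
    exact I.mul_mem_right _ _ (real_smul_mem _ (I.sub_mem hy' hz'))
  refine (pow_le_pow_left₀ Metric.infDist_nonneg (infDist_le_of_sub_mem hd) 2).trans ?_
  have hk : star x * x - star m * m ∈ I := by
    have : star x * x - star m * m = star x * (x - m) + star (x - m) * m := by
      rw [star_sub]; noncomm_ring
    rw [this]
    exact I.add_mem (I.mul_mem_left _ _ hxm)
      (I.mul_mem_right _ _ (star_mem_of_isClosed hI hxm))
  refine I.infDist_sq_le_of_star_mul_self_le hc.le
    (I.mul_mem_right _ p (I.mul_mem_left p _ hk)) ?_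
  have hbound (w : A) (hw : ‖w‖ < √(1 + c)) : star w * w ≤ algebraMap ℝ A (1 + c) := by
    refine CStarAlgebra.star_mul_le_algebraMap_norm_sq.trans (algebraMap_mono A ?_)
    have := pow_le_pow_left₀ (norm_nonneg w) hw.le 2
    rwa [Real.sq_sqrt (by positivity)] at this
  have hpar : star d * d ≤ algebraMap ℝ A (1 + c) - star m * m := by
    have h : star d * d + star m * m = (2⁻¹ : ℝ) • (star y' * y' + star z' * z') := by
      simp only [hddef, hmdef, star_smul, star_add, star_sub, smul_mul_smul_comm, star_trivial,
        mul_add, add_mul, mul_sub, sub_mul]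
      module
    rw [le_sub_iff_add_le, h]
    calc (2⁻¹ : ℝ) • (star y' * y' + star z' * z')
        ≤ (2⁻¹ : ℝ) • (algebraMap ℝ A (1 + c) + algebraMap ℝ A (1 + c)) :=
          smul_le_smul_of_nonneg_left (add_le_add (hbound y' hyn) (hbound z' hzn)) (by positivity)
      _ = algebraMap ℝ A (1 + c) := by module
  calc star (d * p) * (d * p) = star p * (star d * d) * p := by simp [mul_assoc]
    _ ≤ star p * (algebraMap ℝ A (1 + c) - star m * m) * p :=
        star_left_conjugate_le_conjugate hpar p
    _ = c • p + p * (p - star m * m) * p := by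
        simp only [hpsa, Algebra.algebraMap_eq_smul_one, mul_sub, sub_mul, mul_smul_comm,
          smul_mul_assoc, mul_one, hpp]
        module
    _ ≤ algebraMap ℝ A c + p * (p - star m * m) * p := by
        rw [Algebra.algebraMap_eq_smul_one]
        gcongr

/-- The distance from a closed proper ideal to an extreme point of the unit ball is `1`. -/
lemma TwoSidedIdeal.infDist_eq_one_of_extreme {I : TwoSidedIdeal A}
    (hI : IsClosed (I : Set A)) (hIp : (I : Set A) ≠ Set.univ) {x : A} (hx : ‖x‖ ≤ 1)
    (hext : ∀ y z : A, ‖y‖ ≤ 1 → ‖z‖ ≤ 1 → x = (2⁻¹ : ℝ) • (y + z) → y = x ∧ z = x) :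
    Metric.infDist x (I : Set A) = 1 := by
  have h0 : (0 : A) ∈ (I : Set A) := I.zero_mem
  refine le_antisymm ((Metric.infDist_le_dist_of_mem h0).trans (by simpa using hx)) ?_
  by_contra! hlt
  obtain ⟨b, hb, hbn⟩ := exists_sub_mem_norm_lt hlt
  have hxx := mul_star_mul_self_of_extreme hx hext
  have hp : star x * x ∈ I := by
    refine mem_of_isIdempotentElem_of_sub_mem hI (c := star x * b) ?_ ?_ ?_
    · rw [IsIdempotentElem, mul_assoc, ← mul_assoc x, hxx]
    · rw [← mul_sub]
      exact I.mul_mem_left _ _ hb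
    · refine (norm_mul_le _ _).trans_lt ?_
      rw [norm_star]
      nlinarith [norm_nonneg b]
  have hxI : x ∈ I := by
    rw [← hxx, mul_assoc]
    exact I.mul_mem_left _ _ hp
  have h1 : (1 : A) ∈ I := by
    have hdef := defect_mul_mul_defect_of_extreme hx hext 1
    have h : (1 : A) = x * star x + (1 - x * star x) * (star x * x) := by
      rw [mul_one, mul_sub, mul_one, sub_eq_zero] at hdef
      rw [← hdef]
      abel
    rw [h]
    exact I.add_mem (I.mul_mem_right _ _ hxI) (I.mul_mem_left _ _ hp)
  exact hIp (Set.eq_univ_of_forall fun a ↦ by simpa using I.mul_mem_left a 1 h1)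

/-- An extreme point of the unit ball stays extreme modulo a closed ideal. -/
lemma TwoSidedIdeal.half_sub_mem_of_extreme {I : TwoSidedIdeal A}
    (hI : IsClosed (I : Set A)) {x : A} (hx : ‖x‖ ≤ 1)
    (hext : ∀ y z : A, ‖y‖ ≤ 1 → ‖z‖ ≤ 1 → x = (2⁻¹ : ℝ) • (y + z) → y = x ∧ z = x)
    {y z : A} (hy : Metric.infDist y (I : Set A) ≤ 1) (hz : Metric.infDist z (I : Set A) ≤ 1)
    (hm : x - (2⁻¹ : ℝ) • (y + z) ∈ I) : (2⁻¹ : ℝ) • (y - z) ∈ I := by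
  have hxx := mul_star_mul_self_of_extreme hx hext
  have hright := half_sub_mul_star_mul_self_mem hI hxx hy hz hm
  have hleft : x * star x * ((2⁻¹ : ℝ) • (y - z)) ∈ I := by
    have h := half_sub_mul_star_mul_self_mem hI (x := star x) (y := star y) (z := star z)
      (by simpa [mul_assoc] using congrArg star hxx)
      ((infDist_star_le hI y).trans hy) ((infDist_star_le hI z).trans hz)
      (by simpa using star_mem_of_isClosed hI hm)
    simpa [mul_assoc] using star_mem_of_isClosed hI h
  have hdef := defect_mul_mul_defect_of_extreme hx hext ((2⁻¹ : ℝ) • (y - z))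
  set d : A := (2⁻¹ : ℝ) • (y - z)
  have h : d = (1 - x * star x) * (d * (star x * x)) + x * star x * d := by
    rw [← sub_eq_zero, ← hdef]
    noncomm_ring
  rw [h]
  exact I.add_mem (I.mul_mem_left _ _ hright) hleft

end ClosedIdeal

/-- If `I` is a proper closed two-sided ideal in a unital C*-algebra `A` and `x` is an
extreme point of the closed unit ball of `A`, then `x ∉ I`, in fact `dist (x, I) = 1`,
and `x + I` is an extreme point of the closed unit ball of the quotient `A / I`
(extremality in the quotient being expressed via the quotient seminorm
`q a = infDist a I`). -/
theorem extreme_point_quotient {A : Type*} [NormedRing A] [StarRing A]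
    [CStarRing A] [NormedAlgebra ℂ A] [CompleteSpace A] [StarModule ℂ A]
    (I : TwoSidedIdeal A) (hIc : IsClosed (I : Set A)) (hIp : (I : Set A) ≠ Set.univ)
    (x : A) (hx : ‖x‖ ≤ 1)
    (hext : ∀ y z : A, ‖y‖ ≤ 1 → ‖z‖ ≤ 1 → x = (2⁻¹ : ℝ) • (y + z) → y = x ∧ z = x) :
    x ∉ I ∧ Metric.infDist x (I : Set A) = 1 ∧
      ∀ y z : A, Metric.infDist y (I : Set A) ≤ 1 → Metric.infDist z (I : Set A) ≤ 1 →
        Metric.infDist (x - (2⁻¹ : ℝ) • (y + z)) (I : Set A) = 0 →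
        Metric.infDist (x - y) (I : Set A) = 0 ∧ Metric.infDist (x - z) (I : Set A) = 0 := by
  let _ : CStarAlgebra A := { }
  let _ : PartialOrder A := CStarAlgebra.spectralOrder A
  have : StarOrderedRing A := CStarAlgebra.spectralOrderedRing A
  have hdist : Metric.infDist x (I : Set A) = 1 := I.infDist_eq_one_of_extreme hIc hIp hx hext
  refine ⟨fun hxI ↦ ?_, hdist, fun y z hy hz hm ↦ ?_⟩
  · rw [TwoSidedIdeal.mem_iff_infDist_eq_zero hIc, hdist] at hxI
    exact one_ne_zero hxI
  · rw [← TwoSidedIdeal.mem_iff_infDist_eq_zero hIc] at hm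
    have hd : (2⁻¹ : ℝ) • (y - z) ∈ I := I.half_sub_mem_of_extreme hIc hx hext hy hz hm
    rw [← TwoSidedIdeal.mem_iff_infDist_eq_zero hIc, ← TwoSidedIdeal.mem_iff_infDist_eq_zero hIc]
    constructor
    · have h : x - y = (x - (2⁻¹ : ℝ) • (y + z)) - (2⁻¹ : ℝ) • (y - z) := by module
      rw [h]
      exact I.sub_mem hm hd
    · have h : x - z = (x - (2⁻¹ : ℝ) • (y + z)) + (2⁻¹ : ℝ) • (y - z) := by module
      rw [h]
      exact I.add_mem hm hd
end

section
/- Let M be a von Neumann algebra acting on a Hilbert space. Every isometry in M is a C*-extreme point of the closed unit ball of M, and every coisometry in M is a C*-extreme point of the closed unit ball of M. -/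
/-- `x` is a C*-extreme point of the closed unit ball of the von Neumann algebra `M`. -/
def IsCStarExtremePoint {H : Type*} [NormedAddCommGroup H] [InnerProductSpace ℂ H]
    [CompleteSpace H] (M : VonNeumannAlgebra H) (x : H →L[ℂ] H) : Prop :=
  x ∈ M ∧ ‖x‖ ≤ 1 ∧
    ∀ (k : ℕ) (a t : Fin k → (H →L[ℂ] H)),
      (∀ i, a i ∈ M) → (∀ i, ‖a i‖ ≤ 1) → (∀ i, t i ∈ M) →
      (∀ i, ∃ s ∈ M, t i * s = 1 ∧ s * t i = 1) →
      (∑ i, star (t i) * t i) = 1 → x = ∑ i, star (t i) * a i * t i →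
      ∀ i, ∃ u ∈ M, star u * u = 1 ∧ u * star u = 1 ∧ a i = star u * x * u

open Filter Topology

section Intertwiner

variable {H : Type*} [NormedAddCommGroup H] [InnerProductSpace ℂ H] [CompleteSpace H]

theorem inner_star_apply_left (v : H →L[ℂ] H) (ξ η : H) :
    inner ℂ ((star v) ξ) η = inner ℂ ξ (v η) := by
  rw [ContinuousLinearMap.star_eq_adjoint, ContinuousLinearMap.adjoint_inner_left]

theorem norm_apply_of_star_mul_self {v : H →L[ℂ] H} (hv : star v * v = 1) (ξ : H) :
    ‖v ξ‖ = ‖ξ‖ :=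
  (v.norm_map_iff_adjoint_comp_self).2 hv ξ

theorem star_pow_mul_pow {v : H →L[ℂ] H} (hv : star v * v = 1) (n : ℕ) :
    star (v ^ n) * v ^ n = 1 := by
  induction n with
  | zero => simp
  | succ n ih =>
    rw [pow_succ', star_mul, mul_assoc, ← mul_assoc (star v), hv, one_mul, ih]

/-- The defect of an isometry: `‖(1 - vv*)ξ‖² = ‖ξ‖² - ‖v*ξ‖²`. -/
theorem norm_sq_sub_mul_star_apply {v : H →L[ℂ] H} (hv : star v * v = 1) (ξ : H) :
    ‖ξ - v ((star v) ξ)‖ ^ 2 = ‖ξ‖ ^ 2 - ‖(star v) ξ‖ ^ 2 := by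
  rw [@norm_sub_sq ℂ, ← inner_star_apply_left, norm_apply_of_star_mul_self hv,
    inner_self_eq_norm_sq]
  ring

theorem norm_star_apply_le {v : H →L[ℂ] H} (hv : star v * v = 1) (ξ : H) :
    ‖(star v) ξ‖ ≤ ‖ξ‖ := by
  have := norm_sq_sub_mul_star_apply hv ξ
  nlinarith [sq_nonneg ‖ξ - v ((star v) ξ)‖, norm_nonneg ξ, norm_nonneg ((star v) ξ)]

/-- Iterates of `s ↦ y(1 - vv*) + a s v*` starting at `x`; their strong limit intertwines
both `v, a` and `v*, a*`. -/
noncomputable def intertwinerSeq (v a x y : H →L[ℂ] H) : ℕ → (H →L[ℂ] H)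
  | 0 => x
  | n + 1 => y * (1 - v * star v) + a * intertwinerSeq v a x y n * star v

variable {v a x y : H →L[ℂ] H}

theorem intertwinerSeq_succ_mul (hv : star v * v = 1) (n : ℕ) :
    intertwinerSeq v a x y (n + 1) * v = a * intertwinerSeq v a x y n := by
  simp only [intertwinerSeq, add_mul, mul_assoc, sub_mul, hv, one_mul, mul_one, sub_self,
    mul_zero, zero_add]

theorem star_mul_mul_defect (hv : star v * v = 1) (hy : star a * y = y * star v) :
    star a * (y * (1 - v * star v)) = 0 := by
  rw [← mul_assoc, hy, mul_assoc, mul_sub, ← mul_assoc (star v), hv, one_mul, mul_one, sub_self,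
    mul_zero]

theorem star_mul_intertwinerSeq_succ (hv : star v * v = 1) (ha : star a * a = 1)
    (hy : star a * y = y * star v) (n : ℕ) :
    star a * intertwinerSeq v a x y (n + 1) = intertwinerSeq v a x y n * star v := by
  rw [intertwinerSeq, mul_add, star_mul_mul_defect hv hy, zero_add, ← mul_assoc, ← mul_assoc, ha,
    one_mul]

theorem intertwinerSeq_mul_pow (hv : star v * v = 1) (hx : x * v = a * x) (n : ℕ) :
    intertwinerSeq v a x y n * v ^ n = x * v ^ n := by
  induction n with
  | zero => rfl
  | succ n ih =>
    rw [pow_succ', ← mul_assoc, intertwinerSeq_succ_mul hv, mul_assoc, ih, ← mul_assoc, ← hx,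
      mul_assoc]

theorem intertwinerSeq_mul_intertwinerSeq {x' y' : H →L[ℂ] H} (hv : star v * v = 1)
    (ha : star a * a = 1) (hy : star a * y = y * star v) (hxx : x' * x = 1) (hyy : y' * y = 1)
    (n : ℕ) : intertwinerSeq a v x' y' n * intertwinerSeq v a x y n = 1 := by
  induction n with
  | zero => exact hxx
  | succ n ih =>
    have h1 : (1 - a * star a) * a = 0 := by
      rw [sub_mul, mul_assoc, ha, mul_one, one_mul, sub_self]
    have h2 := star_mul_mul_defect hv hy
    rw [intertwinerSeq, add_mul, mul_assoc (v * _), star_mul_intertwinerSeq_succ hv ha hy,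
      mul_assoc v, ← mul_assoc _ _ (star v), ih, one_mul, intertwinerSeq, mul_add, mul_assoc y',
      sub_mul 1, mul_assoc a, h2, mul_zero, sub_zero, one_mul, ← mul_assoc y', hyy, one_mul,
      mul_assoc y', ← mul_assoc (1 - a * star a), ← mul_assoc (1 - a * star a), h1, zero_mul,
      zero_mul, mul_zero, add_zero, sub_add_cancel]

theorem intertwinerSeq_mem (M : VonNeumannAlgebra H) (hv : v ∈ M) (ha : a ∈ M) (hx : x ∈ M)
    (hy : y ∈ M) (n : ℕ) : intertwinerSeq v a x y n ∈ M := by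
  induction n with
  | zero => exact hx
  | succ n ih =>
    exact add_mem (mul_mem hy (sub_mem (one_mem M) (mul_mem hv (star_mem hv))))
      (mul_mem (mul_mem ha ih) (star_mem hv))

theorem norm_intertwinerSeq_apply_le (hv : star v * v = 1) (ha : star a * a = 1)
    (hy : star a * y = y * star v) (n : ℕ) (ξ : H) :
    ‖intertwinerSeq v a x y n ξ‖ ≤ max ‖x‖ ‖y‖ * ‖ξ‖ := by
  induction n generalizing ξ with
  | zero =>
    exact (x.le_opNorm ξ).trans (by gcongr; exact le_max_left _ _)
  | succ n ih =>
    set C := max ‖x‖ ‖y‖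
    set S := intertwinerSeq v a x y n
    have hC : 0 ≤ C := (norm_nonneg x).trans (le_max_left _ _)
    set η := ξ - v ((star v) ξ) with hη
    have hS : intertwinerSeq v a x y (n + 1) ξ = y η + a (S ((star v) ξ)) := by
      simp [intertwinerSeq, hη, S]
    have h0 : (star a) (y η) = 0 := by
      have := congrArg (fun T : H →L[ℂ] H => T ξ) (star_mul_mul_defect hv hy)
      simpa [hη] using this
    have horth : inner ℂ (y η) (a (S ((star v) ξ))) = 0 := by
      rw [← inner_star_apply_left, h0, inner_zero_left]
    have h1 : ‖y η‖ ≤ C * ‖η‖ := (y.le_opNorm η).trans (by gcongr; exact le_max_right _ _)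
    have h2 := ih ((star v) ξ)
    have h3 := norm_sq_sub_mul_star_apply hv ξ
    rw [hS]
    refine (sq_le_sq₀ (norm_nonneg _) (by positivity)).1 ?_
    rw [@norm_add_sq ℂ, horth, norm_apply_of_star_mul_self ha]
    have h1' := pow_le_pow_left₀ (norm_nonneg _) h1 2
    have h2' := pow_le_pow_left₀ (norm_nonneg _) h2 2
    rw [mul_pow] at h1' h2' ⊢
    rw [h3] at h1'
    simp only [map_zero, mul_zero, add_zero]
    linarith

theorem norm_sq_intertwinerSeq_sub_le (hv : star v * v = 1) (ha : star a * a = 1)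
    (hx : x * v = a * x) (hy : star a * y = y * star v) (m n : ℕ) (ξ : H) :
    ‖intertwinerSeq v a x y (m + n) ξ - intertwinerSeq v a x y n ξ‖ ^ 2 ≤
      (2 * max ‖x‖ ‖y‖) ^ 2 *
        (‖(star (v ^ n)) ξ‖ ^ 2 - ‖(star (v ^ (m + n))) ξ‖ ^ 2) := by
  induction n generalizing ξ with
  | zero =>
    have hw := star_pow_mul_pow hv m
    rw [add_zero, pow_zero, star_one, one_apply_eq_self,
      ← norm_sq_sub_mul_star_apply hw, ← mul_pow]
    set η := ξ - (v ^ m) ((star (v ^ m)) ξ) with hη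
    have hS : intertwinerSeq v a x y m ξ - x ξ = intertwinerSeq v a x y m η - x η := by
      have := congrArg (fun T : H →L[ℂ] H => T ((star (v ^ m)) ξ))
        (intertwinerSeq_mul_pow (y := y) hv hx m)
      simp only [mul_apply_eq_comp] at this
      rw [hη, map_sub, map_sub, this]
      abel
    refine pow_le_pow_left₀ (norm_nonneg _) ?_ 2
    change ‖intertwinerSeq v a x y m ξ - x ξ‖ ≤ _
    rw [hS]
    have h1 := norm_intertwinerSeq_apply_le (x := x) hv ha hy m η
    have h2 := norm_intertwinerSeq_apply_le (x := x) hv ha hy 0 η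
    calc _ ≤ _ := norm_sub_le _ _
      _ ≤ _ := add_le_add h1 h2
      _ = _ := by ring
  | succ n ih =>
    have hS : intertwinerSeq v a x y (m + (n + 1)) ξ - intertwinerSeq v a x y (n + 1) ξ =
        a (intertwinerSeq v a x y (m + n) ((star v) ξ) -
          intertwinerSeq v a x y n ((star v) ξ)) := by
      rw [← add_assoc]
      simp [intertwinerSeq]
    have hp (k : ℕ) : (star (v ^ (k + 1))) ξ = (star (v ^ k)) ((star v) ξ) := by
      rw [pow_succ', star_mul, mul_apply_eq_comp]
    rw [hS, norm_apply_of_star_mul_self ha, ← add_assoc, hp, hp]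
    exact ih _

theorem cauchySeq_intertwinerSeq_apply (hv : star v * v = 1) (ha : star a * a = 1)
    (hx : x * v = a * x) (hy : star a * y = y * star v) (ξ : H) :
    CauchySeq fun n => intertwinerSeq v a x y n ξ := by
  set b : ℕ → ℝ := fun n => ‖(star (v ^ n)) ξ‖ ^ 2 with hb
  have hanti : Antitone b := by
    refine antitone_nat_of_succ_le fun n => ?_
    simp only [hb]
    rw [pow_succ v, star_mul, mul_apply_eq_comp]
    exact pow_le_pow_left₀ (norm_nonneg _) (norm_star_apply_le hv _) 2
  have hcau : CauchySeq b :=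
    (tendsto_atTop_ciInf hanti ⟨0, by rintro _ ⟨n, rfl⟩; positivity⟩).cauchySeq
  set K := (2 * max ‖x‖ ‖y‖) ^ 2
  have hK : 0 ≤ K := sq_nonneg _
  rw [Metric.cauchySeq_iff'] at hcau ⊢
  intro ε hε
  obtain ⟨N, hN⟩ := hcau (ε ^ 2 / (K + 1)) (by positivity)
  refine ⟨N, fun n hn => ?_⟩
  obtain ⟨m, rfl⟩ := Nat.exists_eq_add_of_le' hn
  have h1 := norm_sq_intertwinerSeq_sub_le hv ha hx hy m N ξ
  have h2 := hN (m + N) hn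
  rw [Real.dist_eq, abs_sub_comm, abs_of_nonneg (sub_nonneg.2 (hanti hn)),
    lt_div_iff₀ (by positivity)] at h2
  have h3 : 0 ≤ b N - b (m + N) := sub_nonneg.2 (hanti hn)
  rw [dist_eq_norm]
  refine lt_of_pow_lt_pow_left₀ 2 hε.le (h1.trans_lt ?_)
  change K * (b N - b (m + N)) < _
  linarith

theorem exists_tendsto_intertwinerSeq (hv : star v * v = 1) (ha : star a * a = 1)
    (hx : x * v = a * x) (hy : star a * y = y * star v) :
    ∃ s : H →L[ℂ] H, ∀ ξ, Tendsto (fun n => intertwinerSeq v a x y n ξ) atTop (𝓝 (s ξ)) := by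
  choose f hf using fun ξ =>
    cauchySeq_tendsto_of_complete (cauchySeq_intertwinerSeq_apply hv ha hx hy ξ)
  exact ⟨continuousLinearMapOfTendsto _ (tendsto_pi_nhds.2 hf), hf⟩

end Intertwiner

namespace VonNeumannAlgebra

variable {H : Type*} [NormedAddCommGroup H] [InnerProductSpace ℂ H] [CompleteSpace H]

theorem mem_of_commute_commutant (M : VonNeumannAlgebra H) {s : H →L[ℂ] H}
    (h : ∀ c ∈ M.commutant, c * s = s * c) : s ∈ M := by
  rw [← M.commutant_commutant, mem_commutant_iff]
  exact h

theorem mem_of_tendsto_apply (M : VonNeumannAlgebra H) {S : ℕ → (H →L[ℂ] H)} {s : H →L[ℂ] H}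
    (hS : ∀ n, S n ∈ M) (h : ∀ ξ, Tendsto (fun n => S n ξ) atTop (𝓝 (s ξ))) : s ∈ M := by
  refine M.mem_of_commute_commutant fun c hc => ?_
  ext ξ
  refine tendsto_nhds_unique ((c.continuous.tendsto _).comp (h ξ)) ((h (c ξ)).congr fun n => ?_)
  exact congrArg (fun T : H →L[ℂ] H => T ξ) (mem_commutant_iff.1 hc (S n) (hS n))

/-- An invertible element intertwining `v, a` and `v*, a*` can be replaced by its unitary
polar part. -/
theorem exists_unitary_of_intertwiner (M : VonNeumannAlgebra H) {v a s s' : H →L[ℂ] H}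
    (hs : s ∈ M) (hsv : s * v = a * s) (hsv' : star a * s = s * star v)
    (h1 : s' * s = 1) (h2 : s * s' = 1) :
    ∃ u ∈ M, star u * u = 1 ∧ u * star u = 1 ∧ a = star u * v * u := by
  have hpos : 0 ≤ star s * s := star_mul_self_nonneg s
  set h := CFC.sqrt (star s * s)
  have hhh : h * h = star s * s := CFC.sqrt_mul_sqrt_self _ hpos
  have hsa : star h = h := (CFC.sqrt_nonneg (star s * s)).isSelfAdjoint.star_eq
  have hsu : IsUnit s := ⟨⟨s, s', h2, h1⟩, rfl⟩
  have hunit : IsUnit h := (CFC.isUnit_sqrt_iff _ hpos).2 (hsu.star.mul hsu)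
  have hcomm : ∀ c : H →L[ℂ] H, Commute (star s * s) c → Commute h c := fun c hc =>
    Commute.cfcₙ_nnreal hc _
  have hvas : star s * a = v * star s := by
    simpa using congrArg star hsv'
  have hv : Commute h v := hcomm v <| by
    rw [Commute, SemiconjBy, mul_assoc, hsv, ← mul_assoc, hvas, mul_assoc]
  have hhM : h ∈ M := M.mem_of_commute_commutant fun c hc =>
    (hcomm c (mem_commutant_iff.1 hc _ (mul_mem (star_mem hs) hs))).eq.symm
  obtain ⟨g, hg⟩ := hunit
  set k : H →L[ℂ] H := ↑g⁻¹
  have hkh : k * h = 1 := by rw [← hg]; exact g.inv_mul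
  have hhk : h * k = 1 := by rw [← hg]; exact g.mul_inv
  have hkc : ∀ c : H →L[ℂ] H, Commute h c → Commute k c := fun c hc => by
    rw [← hg] at hc
    exact hc.units_inv_left
  have hkM : k ∈ M := M.mem_of_commute_commutant fun c hc =>
    (hkc c (mem_commutant_iff.1 hc _ hhM)).eq.symm
  have hks : star k = k := by
    have : star k * h = 1 := by rw [← hsa, ← star_mul, hhk, star_one]
    rw [← mul_one (star k), ← hhk, ← mul_assoc, this, one_mul]
  have huu : star (s * k) * (s * k) = 1 := by
    rw [star_mul, hks, mul_assoc, ← mul_assoc (star s), ← hhh, mul_assoc h, hhk, mul_one, hkh]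
  have hinv : (s * k) * (h * s') = 1 := by
    rw [mul_assoc, ← mul_assoc k, hkh, one_mul, h2]
  have huu' : (s * k) * star (s * k) = 1 := by
    rw [left_inv_eq_right_inv huu hinv, hinv]
  refine ⟨star (s * k), star_mem (mul_mem hs hkM), by rw [star_star, huu'],
    by rw [star_star, huu], ?_⟩
  rw [star_star, mul_assoc s, (hkc v hv).eq, ← mul_assoc, hsv, mul_assoc a, mul_assoc a, huu',
    mul_one]

/-- Isometries of a von Neumann algebra that are similar in it are unitarily equivalent in it. -/
theorem exists_unitary_of_similar_isometries (M : VonNeumannAlgebra H) {v a t s : H →L[ℂ] H}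
    (hvM : v ∈ M) (haM : a ∈ M) (htM : t ∈ M) (hsM : s ∈ M) (hv : star v * v = 1)
    (ha : star a * a = 1) (hts : t * s = 1) (hst : s * t = 1) (htv : a * t = t * v) :
    ∃ u ∈ M, star u * u = 1 ∧ u * star u = 1 ∧ a = star u * v * u := by
  have hsa : s * a = v * s := by
    rw [← mul_one (s * a), ← hts, mul_assoc, ← mul_assoc a, htv, ← mul_assoc, ← mul_assoc, hst,
      one_mul]
  have hy : star a * star s = star s * star v := by rw [← star_mul, hsa, star_mul]
  have hy' : star v * star t = star t * star a := by rw [← star_mul, ← htv, star_mul]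
  have hstar1 : star t * star s = 1 := by rw [← star_mul, hst, star_one]
  have hstar2 : star s * star t = 1 := by rw [← star_mul, hts, star_one]
  obtain ⟨p, hp⟩ := exists_tendsto_intertwinerSeq hv ha htv.symm hy
  obtain ⟨q, hq⟩ := exists_tendsto_intertwinerSeq ha hv hsa hy'
  have hmul : ∀ {v a x y x' y' p q : H →L[ℂ] H}, star v * v = 1 → star a * a = 1 →
      star v * y' = y' * star a → (∀ n, intertwinerSeq a v x' y' n * intertwinerSeq v a x y n = 1) →
      (∀ ξ, Tendsto (fun n => intertwinerSeq v a x y n ξ) atTop (𝓝 (p ξ))) →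
      (∀ ξ, Tendsto (fun n => intertwinerSeq a v x' y' n ξ) atTop (𝓝 (q ξ))) → q * p = 1 := by
    intro v a x y x' y' p q hv ha hy' hone hp hq
    ext ξ
    refine tendsto_nhds_unique (hq (p ξ)) ?_
    rw [one_apply_eq_self, tendsto_iff_norm_sub_tendsto_zero]
    have hlim := ((tendsto_iff_norm_sub_tendsto_zero.1 (hp ξ)).const_mul (max ‖x'‖ ‖y'‖))
    rw [mul_zero] at hlim
    refine squeeze_zero (fun _ => norm_nonneg _) (fun n => ?_) hlim
    have hξ : ξ = intertwinerSeq a v x' y' n (intertwinerSeq v a x y n ξ) := by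
      rw [← mul_apply_eq_comp, hone, one_apply_eq_self]
    rw [norm_sub_rev]
    conv_lhs => enter [1, 1]; rw [hξ]
    rw [← map_sub]
    exact norm_intertwinerSeq_apply_le ha hv hy' n _
  have hqp : q * p = 1 := hmul hv ha hy'
    (intertwinerSeq_mul_intertwinerSeq hv ha hy hst hstar1) hp hq
  have hpq : p * q = 1 := hmul ha hv hy
    (intertwinerSeq_mul_intertwinerSeq ha hv hy' hts hstar2) hq hp
  have hpM : p ∈ M :=
    M.mem_of_tendsto_apply (intertwinerSeq_mem M hvM haM htM (star_mem hsM)) hp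
  refine M.exists_unitary_of_intertwiner hpM ?_ ?_ hqp hpq
  · ext ξ
    refine tendsto_nhds_unique ((hp (v ξ)).comp (tendsto_add_atTop_nat 1))
      (((a.continuous.tendsto _).comp (hp ξ)).congr fun n => ?_)
    exact congrArg (fun T : H →L[ℂ] H => T ξ) (intertwinerSeq_succ_mul hv n).symm
  · ext ξ
    refine tendsto_nhds_unique
      (((star a).continuous.tendsto _).comp ((hp ξ).comp (tendsto_add_atTop_nat 1)))
      ((hp ((star v) ξ)).congr fun n => ?_)
    exact congrArg (fun T : H →L[ℂ] H => T ξ) (star_mul_intertwinerSeq_succ hv ha hy n).symm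

end VonNeumannAlgebra

section Convexity

variable {H : Type*} [NormedAddCommGroup H] [InnerProductSpace ℂ H] [CompleteSpace H]
  {ι : Type*} [Fintype ι] {v : H →L[ℂ] H} {a t : ι → (H →L[ℂ] H)}

theorem sum_norm_sq_apply (ht : ∑ i, star (t i) * t i = 1) (ξ : H) :
    ∑ i, ‖t i ξ‖ ^ 2 = ‖ξ‖ ^ 2 := by
  have h := congrArg (fun T : H →L[ℂ] H => RCLike.re (inner ℂ (T ξ) ξ)) ht
  simpa [sum_apply, sum_inner, inner_star_apply_left, inner_self_eq_norm_sq,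
    -inner_self_eq_norm_sq_to_K, ← RCLike.re_eq_complex_re] using h

/-- If a C*-convex combination of contractions is an isometry `v`, then every coefficient
intertwines `v` with the corresponding contraction. -/
theorem mul_coeff_eq_coeff_mul (hv : star v * v = 1) (ha : ∀ i, ‖a i‖ ≤ 1)
    (ht : ∑ i, star (t i) * t i = 1) (hx : v = ∑ i, star (t i) * a i * t i) (i : ι) :
    a i * t i = t i * v := by
  ext ξ
  have h1 : ∑ i, RCLike.re (inner ℂ (a i (t i ξ)) (t i (v ξ))) = ‖v ξ‖ ^ 2 := by
    have h := congrArg (fun T : H →L[ℂ] H => RCLike.re (inner ℂ (T ξ) (v ξ))) hx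
    simp only [inner_self_eq_norm_sq, sum_apply, sum_inner, map_sum,
      mul_apply_eq_comp, inner_star_apply_left] at h
    exact h.symm
  have h2 : ∑ i, ‖a i (t i ξ) - t i (v ξ)‖ ^ 2 ≤ 0 := by
    calc ∑ i, ‖a i (t i ξ) - t i (v ξ)‖ ^ 2
        = ∑ i, (‖a i (t i ξ)‖ ^ 2 - 2 * RCLike.re (inner ℂ (a i (t i ξ)) (t i (v ξ)))
            + ‖t i (v ξ)‖ ^ 2) := by simp only [@norm_sub_sq ℂ]
      _ ≤ ∑ i, (‖t i ξ‖ ^ 2 - 2 * RCLike.re (inner ℂ (a i (t i ξ)) (t i (v ξ)))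
            + ‖t i (v ξ)‖ ^ 2) := by
          gcongr with j
          exact (a j).le_of_opNorm_le (ha j) _ |>.trans_eq (one_mul _)
      _ = 0 := by
          rw [Finset.sum_add_distrib, Finset.sum_sub_distrib, ← Finset.mul_sum, h1,
            sum_norm_sq_apply ht, sum_norm_sq_apply ht, norm_apply_of_star_mul_self hv]
          ring
  have h3 := (Finset.sum_eq_zero_iff_of_nonneg (fun i _ => sq_nonneg _)).1
    (h2.antisymm (Finset.sum_nonneg fun i _ => sq_nonneg _)) i (Finset.mem_univ i)
  exact sub_eq_zero.1 (norm_eq_zero.1 (pow_eq_zero_iff two_ne_zero |>.1 h3))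

theorem star_mul_self_of_mul_coeff_eq (hv : star v * v = 1) (ha : ∀ i, ‖a i‖ ≤ 1)
    (ht : ∑ i, star (t i) * t i = 1) (h : ∀ i, a i * t i = t i * v) (i : ι) {s : H →L[ℂ] H}
    (hs : t i * s = 1) : star (a i) * a i = 1 := by
  refine ((a i).norm_map_iff_adjoint_comp_self).1 fun η => ?_
  set ξ := s η
  have hη : t i ξ = η := by
    rw [← mul_apply_eq_comp, hs, one_apply_eq_self]
  have hle : ∀ j ∈ Finset.univ, ‖a j (t j ξ)‖ ^ 2 ≤ ‖t j ξ‖ ^ 2 := fun j _ =>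
    pow_le_pow_left₀ (norm_nonneg _)
      (((a j).le_of_opNorm_le (ha j) _).trans_eq (one_mul _)) 2
  have hsum : ∑ j, ‖a j (t j ξ)‖ ^ 2 = ∑ j, ‖t j ξ‖ ^ 2 := by
    have hj (j : ι) : a j (t j ξ) = t j (v ξ) :=
      congrArg (fun T : H →L[ℂ] H => T ξ) (h j)
    simp only [hj]
    rw [sum_norm_sq_apply ht, sum_norm_sq_apply ht, norm_apply_of_star_mul_self hv]
  have := (Finset.sum_eq_sum_iff_of_le hle).1 hsum i (Finset.mem_univ i)
  rw [hη] at this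
  exact (sq_eq_sq₀ (norm_nonneg _) (norm_nonneg _)).1 this

end Convexity

theorem isCStarExtremePoint_of_isometry {H : Type*} [NormedAddCommGroup H]
    [InnerProductSpace ℂ H] [CompleteSpace H] (M : VonNeumannAlgebra H)
    {v : H →L[ℂ] H} (hvM : v ∈ M) (hv : star v * v = 1) : IsCStarExtremePoint M v := by
  refine ⟨hvM, v.opNorm_le_bound zero_le_one fun ξ => ?_, ?_⟩
  · rw [norm_apply_of_star_mul_self hv, one_mul]
  · intro k a t haM ha htM hinv ht hx i
    obtain ⟨s, hsM, hts, hst⟩ := hinv i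
    have h := mul_coeff_eq_coeff_mul hv ha ht hx
    exact M.exists_unitary_of_similar_isometries hvM (haM i) (htM i) hsM hv
      (star_mul_self_of_mul_coeff_eq hv ha ht h i hts) hts hst (h i)

theorem IsCStarExtremePoint.of_star {H : Type*} [NormedAddCommGroup H]
    [InnerProductSpace ℂ H] [CompleteSpace H] {M : VonNeumannAlgebra H}
    {v : H →L[ℂ] H} (h : IsCStarExtremePoint M (star v)) : IsCStarExtremePoint M v := by
  obtain ⟨hM, hn, hext⟩ := h
  refine ⟨by simpa using star_mem hM, by rwa [norm_star] at hn, ?_⟩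
  intro k a t haM ha htM hinv ht hx i
  obtain ⟨u, huM, hu1, hu2, hu⟩ := hext k (fun i => star (a i)) t (fun i => star_mem (haM i))
    (fun i => by rw [norm_star]; exact ha i) htM hinv ht
    (by rw [hx, star_sum]; simp only [star_mul, star_star, mul_assoc]) i
  refine ⟨u, huM, hu1, hu2, ?_⟩
  simpa [mul_assoc] using congrArg star hu

/-- Every isometry and every coisometry in a von Neumann algebra `M` is a C*-extreme
point of the closed unit ball of `M`. -/
theorem isometry_coisometry_cstarExtreme {H : Type*} [NormedAddCommGroup H]
    [InnerProductSpace ℂ H] [CompleteSpace H] (M : VonNeumannAlgebra H)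
    (v : H →L[ℂ] H) (hvM : v ∈ M) (hv : star v * v = 1 ∨ v * star v = 1) :
    IsCStarExtremePoint M v := by
  rcases hv with hv | hv
  · exact isCStarExtremePoint_of_isometry M hvM hv
  · exact (isCStarExtremePoint_of_isometry M (star_mem hvM) (by rwa [star_star])).of_star
end
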